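/- Let (p, ≺) be a Pauli flow for a labelled open graph Γ = (G, I, O, λ) and let u, v ∈ V∖O satisfy u ≺ v. Define p' : V∖O → 𝒫(V∖I) by p'(u) := p(u) Δ p(v) and p'(w) := p(w) for all w ∈ V∖O with w ≠ u. Then (p', ≺) is a Pauli flow for Γ. Moreover, if (p, ≺) is maximally delayed, then so is (p', ≺). -/

import Mathlib

open scoped symmDiff

inductive MeasLabel : Type
  | XY | XZ | YZ | X | Y | Z
deriving DecidableEq

/-- A labelled open graph: a finite simple graph with input and output sets and a
measurement labelling (only its values on non-outputs are ever used). -/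
structure LOG (V : Type) [Fintype V] where
  G : SimpleGraph V
  I : Set V
  O : Set V
  lam : V → MeasLabel

namespace LOG

variable {V : Type} [Fintype V]

/-- The odd neighbourhood of `A`: vertices with an odd number of neighbours in `A`. -/
def odd (G : SimpleGraph V) (A : Set V) : Set V :=
  {w | Odd ((G.neighborSet w ∩ A).ncard)}

/-- `v` is a measured (non-output) vertex whose label lies in `s`.  (The labelling of a
labelled open graph is only defined on non-outputs.) -/
def labIn (Γ : LOG V) (v : V) (s : Set MeasLabel) : Prop :=
  v ∉ Γ.O ∧ Γ.lam v ∈ s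

/-- The Pauli flow conditions for a map `p` and a strict partial order `prec` (`≺`). -/
structure IsPauliFlow (Γ : LOG V) (p : V → Set V) (prec : V → V → Prop) : Prop where
  irrefl : ∀ a, ¬ prec a a
  trans : ∀ a b c, prec a b → prec b c → prec a c
  psub : ∀ u, u ∉ Γ.O → ∀ v ∈ p u, v ∉ Γ.I
  pf1 : ∀ u, u ∉ Γ.O → ∀ v ∈ p u, u ≠ v →
    ¬ Γ.labIn v {MeasLabel.X, MeasLabel.Y} → prec u v
  pf2 : ∀ u, u ∉ Γ.O → ∀ v ∈ odd Γ.G (p u), u ≠ v →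
    ¬ Γ.labIn v {MeasLabel.Y, MeasLabel.Z} → prec u v
  pf3 : ∀ u, u ∉ Γ.O → ∀ v, ¬ prec u v → u ≠ v →
    Γ.labIn v {MeasLabel.Y} → (v ∈ p u ↔ v ∈ odd Γ.G (p u))
  pf4 : ∀ u, u ∉ Γ.O → Γ.lam u = MeasLabel.XY → u ∉ p u ∧ u ∈ odd Γ.G (p u)
  pf5 : ∀ u, u ∉ Γ.O → Γ.lam u = MeasLabel.XZ → u ∈ p u ∧ u ∈ odd Γ.G (p u)
  pf6 : ∀ u, u ∉ Γ.O → Γ.lam u = MeasLabel.YZ → u ∈ p u ∧ u ∉ odd Γ.G (p u)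
  pf7 : ∀ u, u ∉ Γ.O → Γ.lam u = MeasLabel.X → u ∈ odd Γ.G (p u)
  pf8 : ∀ u, u ∉ Γ.O → Γ.lam u = MeasLabel.Z → u ∈ p u
  pf9 : ∀ u, u ∉ Γ.O → Γ.lam u = MeasLabel.Y →
    ((u ∈ p u ∧ u ∉ odd Γ.G (p u)) ∨ (u ∉ p u ∧ u ∈ odd Γ.G (p u)))

/-- `phat` is focussed over `S`. -/
def FocussedOver (Γ : LOG V) (phat S : Set V) : Prop :=
  (∀ w ∈ S ∩ phat, Γ.lam w ∈ ({MeasLabel.XY, MeasLabel.X, MeasLabel.Y} : Set MeasLabel)) ∧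
  (∀ w ∈ S ∩ odd Γ.G phat,
    Γ.lam w ∈ ({MeasLabel.XZ, MeasLabel.YZ, MeasLabel.Y, MeasLabel.Z} : Set MeasLabel)) ∧
  (∀ w ∈ S, Γ.lam w = MeasLabel.Y → (w ∈ phat ↔ w ∈ odd Γ.G phat))

/-- A focussed set for `Γ`: a subset of the non-inputs that is focussed over all
non-outputs. -/
def IsFocussedSet (Γ : LOG V) (phat : Set V) : Prop :=
  (∀ v ∈ phat, v ∉ Γ.I) ∧ FocussedOver Γ phat {v | v ∉ Γ.O}

/-- A Pauli flow map `p` is focussed if each `p v` is focussed over the measured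
vertices other than `v`. -/
def IsFocussed (Γ : LOG V) (p : V → Set V) : Prop :=
  ∀ v, v ∉ Γ.O → FocussedOver Γ (p v) ({w | w ∉ Γ.O} \ {v})

/-- `Vcum prec k` is `V_{∪k}^≺`, the union of the layers up to depth `k`. -/
def Vcum (prec : V → V → Prop) : ℕ → Set V
  | 0 => {v | ∀ w, ¬ prec v w}
  | k + 1 => Vcum prec k ∪ {v | v ∉ Vcum prec k ∧ ∀ w, w ∉ Vcum prec k → ¬ prec v w}

/-- `Vlayer prec k` is `V_k^≺`, the `≺`-maximal elements among the vertices not of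
smaller depth. -/
def Vlayer (prec : V → V → Prop) : ℕ → Set V
  | 0 => {v | ∀ w, ¬ prec v w}
  | k + 1 => {v | v ∉ Vcum prec k ∧ ∀ w, w ∉ Vcum prec k → ¬ prec v w}

/-- `prec` is more delayed than `prec'`. -/
def MoreDelayed (prec prec' : V → V → Prop) : Prop :=
  (∀ k, (Vcum prec' k).ncard ≤ (Vcum prec k).ncard) ∧
  ∃ k, (Vcum prec' k).ncard < (Vcum prec k).ncard

/-- A maximally delayed Pauli flow: no Pauli flow for the same labelled open graph is
more delayed. -/
def IsMaxDelayed (Γ : LOG V) (p : V → Set V) (prec : V → V → Prop) : Prop :=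
  IsPauliFlow Γ p prec ∧
  ∀ q prec', IsPauliFlow Γ q prec' → ¬ MoreDelayed prec' prec

/-- `Λ_u^P`: the measured vertices other than `u` whose label is `P`. -/
def LamP (Γ : LOG V) (u : V) (P : MeasLabel) : Set V :=
  {v | v ∉ Γ.O ∧ v ≠ u ∧ Γ.lam v = P}

/-- `V_{k+1}^{≺,XY}` where `A = V_{∪k}^≺`. -/
def VXY (Γ : LOG V) (A : Set V) : Set V :=
  {u | u ∉ Γ.O ∧ Γ.lam u ∈ ({MeasLabel.XY, MeasLabel.X, MeasLabel.Y} : Set MeasLabel) ∧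
    ∃ K, K ⊆ (A ∪ LamP Γ u MeasLabel.X ∪ LamP Γ u MeasLabel.Y) ∩ {v | v ∉ Γ.I} ∧
      (K ∩ LamP Γ u MeasLabel.Y) \ A = (odd Γ.G K ∩ LamP Γ u MeasLabel.Y) \ A ∧
      odd Γ.G K \ (A ∪ LamP Γ u MeasLabel.Y ∪ LamP Γ u MeasLabel.Z) = {u}}

/-- `V_{k+1}^{≺,XZ}` where `A = V_{∪k}^≺`. -/
def VXZ (Γ : LOG V) (A : Set V) : Set V :=
  {u | u ∉ Γ.O ∧ Γ.lam u ∈ ({MeasLabel.XZ, MeasLabel.X, MeasLabel.Z} : Set MeasLabel) ∧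
    ∃ K, K ⊆ (A ∪ LamP Γ u MeasLabel.X ∪ LamP Γ u MeasLabel.Y) ∩ {v | v ∉ Γ.I} ∧
      (K ∩ LamP Γ u MeasLabel.Y) \ A = (odd Γ.G (K ∪ {u}) ∩ LamP Γ u MeasLabel.Y) \ A ∧
      odd Γ.G (K ∪ {u}) \ (A ∪ LamP Γ u MeasLabel.Y ∪ LamP Γ u MeasLabel.Z) = {u}}

/-- `V_{k+1}^{≺,YZ}` where `A = V_{∪k}^≺`. -/
def VYZ (Γ : LOG V) (A : Set V) : Set V :=
  {u | u ∉ Γ.O ∧ Γ.lam u ∈ ({MeasLabel.YZ, MeasLabel.Y, MeasLabel.Z} : Set MeasLabel) ∧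
    ∃ K, K ⊆ (A ∪ LamP Γ u MeasLabel.X ∪ LamP Γ u MeasLabel.Y) ∩ {v | v ∉ Γ.I} ∧
      (K ∩ LamP Γ u MeasLabel.Y) \ A = (odd Γ.G (K ∪ {u}) ∩ LamP Γ u MeasLabel.Y) \ A ∧
      odd Γ.G (K ∪ {u}) \ (A ∪ LamP Γ u MeasLabel.Y ∪ LamP Γ u MeasLabel.Z) = ∅}

end LOG


theorem LOG.mem_odd_symmDiff {V : Type} [Fintype V] (G : SimpleGraph V) (A B : Set V) (w : V) :
    w ∈ LOG.odd G (A ∆ B) ↔ ¬ (w ∈ LOG.odd G A ↔ w ∈ LOG.odd G B) := by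
  unfold LOG.odd
  simp only [Set.mem_ofPred_eq]
  set N := G.neighborSet w
  have h1 := Set.ncard_inter_add_ncard_sdiff_eq_ncard (N ∩ A) B (Set.toFinite _)
  have h2 := Set.ncard_inter_add_ncard_sdiff_eq_ncard (N ∩ B) A (Set.toFinite _)
  have h3 : N ∩ (A ∆ B) = ((N ∩ A) \ B) ∪ ((N ∩ B) \ A) := by
    ext x; simp only [Set.mem_inter_iff, Set.mem_symmDiff, Set.mem_union, Set.mem_sdiff]; tauto
  have h4 : Disjoint ((N ∩ A) \ B) ((N ∩ B) \ A) := by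
    rw [Set.disjoint_left]; rintro x ⟨_, h⟩ ⟨⟨_, h'⟩, _⟩; exact h h'
  have h5 : N ∩ B ∩ A = N ∩ A ∩ B := by
    ext x; simp only [Set.mem_inter_iff]; tauto
  rw [h3, Set.ncard_union_eq h4 (Set.toFinite _) (Set.toFinite _), ← h1, ← h2, h5]
  simp only [Nat.odd_iff]
  omega

open LOG in
/-- adding the correction set of a later vertex `v` to that of `u`
preserves the Pauli flow property, and preserves maximal delayedness. -/
theorem pauliFlow_add_correction_sets {V : Type} [Fintype V] (Γ : LOG V)
    (p : V → Set V) (prec : V → V → Prop) (hpf : IsPauliFlow Γ p prec)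
    (u v : V) (hu : u ∉ Γ.O) (hv : v ∉ Γ.O) (huv : prec u v)
    (p' : V → Set V)
    (hp'u : p' u = p u ∆ p v)
    (hp'w : ∀ w, w ∉ Γ.O → w ≠ u → p' w = p w) :
    IsPauliFlow Γ p' prec ∧ (IsMaxDelayed Γ p prec → IsMaxDelayed Γ p' prec) := by
  have key : IsPauliFlow Γ p' prec := by
    have hm : ∀ w, w ∈ p' u ↔ ¬ (w ∈ p u ↔ w ∈ p v) := by
      intro w; rw [hp'u, Set.mem_symmDiff]; tauto
    have ho : ∀ w, w ∈ odd Γ.G (p' u) ↔ ¬ (w ∈ odd Γ.G (p u) ↔ w ∈ odd Γ.G (p v)) := by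
      intro w; rw [hp'u, mem_odd_symmDiff]
    have hne : u ≠ v := by rintro rfl; exact hpf.irrefl _ huv
    have hvu : ¬ prec v u := fun h => hpf.irrefl _ (hpf.trans _ _ _ huv h)
    have a1 := fun h h' => hvu (hpf.pf1 v hv u h hne.symm h')
    have a2 := fun h h' => hvu (hpf.pf2 v hv u h hne.symm h')
    have a3 := hpf.pf3 v hv u hvu hne.symm
    simp only [labIn, Set.mem_insert_iff, Set.mem_singleton_iff] at a1 a2 a3
    refine ⟨hpf.irrefl, hpf.trans, ?_, ?_, ?_, ?_, ?_, ?_, ?_, ?_, ?_, ?_⟩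
    all_goals
      intro a ha
      by_cases hau : a = u
      swap
      · rw [hp'w a ha hau]
        first
        | exact hpf.psub a ha
        | exact hpf.pf1 a ha
        | exact hpf.pf2 a ha
        | exact hpf.pf3 a ha
        | exact hpf.pf4 a ha
        | exact hpf.pf5 a ha
        | exact hpf.pf6 a ha
        | exact hpf.pf7 a ha
        | exact hpf.pf8 a ha
        | exact hpf.pf9 a ha
      subst hau
      simp only [hm, ho]
    · intro w hw
      have := hpf.psub a ha w
      have := hpf.psub v hv w
      tauto
    · intro w hw h1 h2
      by_cases hwv : v = w
      · exact hwv ▸ huv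
      have h3 := fun h => hpf.pf1 a ha w h h1 h2
      have h4 := fun h => hpf.trans _ _ _ huv (hpf.pf1 v hv w h hwv h2)
      tauto
    · intro w hw h1 h2
      by_cases hwv : v = w
      · exact hwv ▸ huv
      have h3 := fun h => hpf.pf2 a ha w h h1 h2
      have h4 := fun h => hpf.trans _ _ _ huv (hpf.pf2 v hv w h hwv h2)
      tauto
    · intro w hw h1 h2
      have hwv : v ≠ w := by rintro rfl; exact hw huv
      have h3 := hpf.pf3 a ha w hw h1 h2
      have h4 := hpf.pf3 v hv w (fun h => hw (hpf.trans _ _ _ huv h)) hwv h2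
      rw [h3, h4]
    · intro hl
      have := hpf.pf4 a ha hl
      simp [hl] at a1 a2
      tauto
    · intro hl
      have := hpf.pf5 a ha hl
      simp [hl] at a1 a2
      tauto
    · intro hl
      have := hpf.pf6 a ha hl
      simp [hl] at a1 a2
      tauto
    · intro hl
      have := hpf.pf7 a ha hl
      simp [hl] at a2
      tauto
    · intro hl
      have := hpf.pf8 a ha hl
      simp [hl] at a1
      tauto
    · intro hl
      have := hpf.pf9 a ha hl
      have h3 := a3 ⟨ha, hl⟩
      rw [h3]
      clear * - this
      tauto
  exact ⟨key, fun h => ⟨key, h.2⟩⟩
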